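/- For every real symplectic matrix M ∈ Sp(2g,ℝ), written in g×g blocks M = [[A,B],[C,D]], and every point τ of the Siegel upper half space H_g, the matrix Cτ + D is invertible, and the matrix (Aτ + B)(Cτ + D)⁻¹ is again a symmetric complex g×g matrix whose imaginary part is positive definite (i.e. it again lies in H_g). -/

import Mathlib

open Matrix Complex

noncomputable section

/-- The standard symplectic form matrix `J = [[0, 1_g], [-1_g, 0]]`. -/
def symJ (g : ℕ) (R : Type*) [CommRing R] : Matrix (Fin g ⊕ Fin g) (Fin g ⊕ Fin g) R :=
  Matrix.fromBlocks 0 1 (-1) 0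

/-- A `2g × 2g` matrix `M` is symplectic if `Mᵀ * J * M = J`. -/
def IsSymplectic {g : ℕ} {R : Type*} [CommRing R]
    (M : Matrix (Fin g ⊕ Fin g) (Fin g ⊕ Fin g) R) : Prop :=
  Mᵀ * symJ g R * M = symJ g R

/-- The Siegel upper half space: complex symmetric `g × g` matrices with positive
definite imaginary part. -/
def SiegelUpperHalfSpace (g : ℕ) : Set (Matrix (Fin g) (Fin g) ℂ) :=
  {τ | τ.IsSymm ∧ (Matrix.of fun i j => (τ i j).im).PosDef}

section

open scoped ComplexOrder

variable {n : Type*} [Fintype n] [DecidableEq n]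

/-- A real positive definite matrix stays positive definite over `ℂ`. -/
theorem Matrix.PosDef.map_ofReal {Y : Matrix n n ℝ} (hY : Y.PosDef) :
    (Y.map Complex.ofRealHom).PosDef := by
  open scoped MatrixOrder Matrix.Norms.L2Operator in
  obtain ⟨S, hS, hYS⟩ :=
    CStarAlgebra.isStrictlyPositive_iff_eq_star_mul_self.mp hY.isStrictlyPositive
  have hmap : Y.map Complex.ofRealHom =
      (S.map Complex.ofRealHom)ᴴ * S.map Complex.ofRealHom := by
    rw [hYS, Matrix.map_mul, star_eq_conjTranspose]
    congr 1
    ext i j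
    simp
  rw [hmap]
  refine PosDef.conjTranspose_mul_self _ (mulVec_injective_of_isUnit ?_)
  exact hS.map Complex.ofRealHom.mapMatrix

/-- A real matrix which is positive definite over `ℂ` is positive definite over `ℝ`. -/
theorem Matrix.PosDef.of_map_ofReal {n : Type*} [Fintype n] {Y : Matrix n n ℝ}
    (hY : (Y.map Complex.ofRealHom).PosDef) :
    Y.PosDef := by
  refine .of_dotProduct_mulVec_pos ?_ fun x hx ↦ ?_
  · ext i j
    simpa using hY.isHermitian.apply i j
  · have hx' : Complex.ofRealHom ∘ x ≠ 0 := fun h ↦ hx <| by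
      ext i
      simpa using congrFun h i
    have h := hY.dotProduct_mulVec_pos hx'
    have hstar : star (Complex.ofRealHom ∘ x) = Complex.ofRealHom ∘ x := by
      ext i
      simp
    have hmulVec : Y.map Complex.ofRealHom *ᵥ (Complex.ofRealHom ∘ x) =
        Complex.ofRealHom ∘ (Y *ᵥ x) :=
      funext fun i ↦ (Complex.ofRealHom.map_mulVec Y x i).symm
    rw [hstar, hmulVec, ← RingHom.map_dotProduct] at h
    simpa using h

/-- For a complex symmetric matrix, `τ - τᴴ` is `2i` times the imaginary part. -/
theorem Matrix.IsSymm.sub_conjTranspose {n : Type*} {τ : Matrix n n ℂ} (hτ : τ.IsSymm) :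
    τ - τᴴ = (2 * I) • (Matrix.of fun i j ↦ (τ i j).im).map Complex.ofRealHom := by
  ext i j
  simp only [sub_apply, conjTranspose_apply, hτ.apply i j, smul_apply, map_apply, of_apply,
    smul_eq_mul, Complex.star_def, Complex.ofRealHom_eq_coe, Complex.sub_conj]
  push_cast
  ring

/-- If `Qᴴ * P - Pᴴ * Q = 2i Y` with `Y` positive definite, then `Q` is invertible. -/
theorem isUnit_of_conjTranspose_mul_sub_eq_smul_posDef {P Q Y : Matrix n n ℂ} (hY : Y.PosDef)
    (h : Qᴴ * P - Pᴴ * Q = (2 * I) • Y) : IsUnit Q := by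
  rw [isUnit_iff_isUnit_det, isUnit_iff_ne_zero]
  intro hdet
  obtain ⟨v, hv, hQv⟩ := exists_mulVec_eq_zero_iff.mpr hdet
  have hpos := hY.dotProduct_mulVec_pos hv
  have hzero : star v ⬝ᵥ ((Qᴴ * P - Pᴴ * Q) *ᵥ v) = 0 := by
    rw [sub_mulVec, dotProduct_sub, ← mulVec_mulVec, ← mulVec_mulVec, hQv, mulVec_zero,
      dotProduct_zero, dotProduct_mulVec, ← star_mulVec, hQv, star_zero, zero_dotProduct, sub_zero]
  rw [h, smul_mulVec, dotProduct_smul, smul_eq_mul] at hzero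
  exact hpos.ne' (by simpa using hzero)

/-- If `Pᵀ * Q` is symmetric and `Qᴴ * P - Pᴴ * Q = 2i Y` with `Y` positive definite, then
`P * Q⁻¹` is symmetric with positive definite imaginary part. -/
theorem mul_inv_isSymm_and_im_posDef {P Q Y : Matrix n n ℂ} (hY : Y.PosDef)
    (hsymm : Pᵀ * Q = Qᵀ * P) (h : Qᴴ * P - Pᴴ * Q = (2 * I) • Y) :
    (P * Q⁻¹).IsSymm ∧ (Matrix.of fun i j ↦ ((P * Q⁻¹) i j).im).PosDef := by
  have hQ := isUnit_of_conjTranspose_mul_sub_eq_smul_posDef hY h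
  have hdet : IsUnit Q.det := (isUnit_iff_isUnit_det Q).mp hQ
  have hdetT : IsUnit Qᵀ.det := by rwa [det_transpose]
  have hdetH : IsUnit Qᴴ.det := by rw [det_conjTranspose]; exact hdet.star
  have hS : (P * Q⁻¹).IsSymm := by
    rw [IsSymm, transpose_mul, transpose_nonsing_inv]
    calc Qᵀ⁻¹ * Pᵀ = Qᵀ⁻¹ * (Pᵀ * Q) * Q⁻¹ := by
          rw [← Matrix.mul_assoc, mul_nonsing_inv_cancel_right _ _ hdet]
      _ = P * Q⁻¹ := by rw [hsymm, nonsing_inv_mul_cancel_left _ _ hdetT]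
  refine ⟨hS, .of_map_ofReal ?_⟩
  have hdiff : (2 * I) • (Matrix.of fun i j ↦ ((P * Q⁻¹) i j).im).map Complex.ofRealHom =
      (2 * I) • ((Q⁻¹)ᴴ * Y * Q⁻¹) := by
    rw [← hS.sub_conjTranspose, ← Matrix.smul_mul, ← Matrix.mul_smul, ← h, Matrix.mul_sub,
      Matrix.sub_mul, conjTranspose_mul, conjTranspose_nonsing_inv,
      nonsing_inv_mul_cancel_left _ _ hdetH, ← Matrix.mul_assoc,
      mul_nonsing_inv_cancel_right _ _ hdet]
  rw [smul_right_injective _ (by simp : (2 * I : ℂ) ≠ 0) hdiff]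
  refine hY.conjTranspose_mul_mul_same (mulVec_injective_of_isUnit ?_)
  exact (isUnit_nonsing_inv_iff).mpr hQ

end

/-- The block relations satisfied by a symplectic matrix. -/
theorem IsSymplectic.fromBlocks_relations {g : ℕ} {R : Type*} [CommRing R]
    {A B C D : Matrix (Fin g) (Fin g) R} (hM : IsSymplectic (fromBlocks A B C D)) :
    Cᵀ * A - Aᵀ * C = 0 ∧ Dᵀ * B - Bᵀ * D = 0 ∧
      Aᵀ * D - Cᵀ * B = 1 ∧ Dᵀ * A - Bᵀ * C = 1 := by
  simp only [IsSymplectic, symJ, fromBlocks_transpose, fromBlocks_multiply, fromBlocks_inj,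
    mul_zero, mul_one, zero_add, mul_neg, add_zero, neg_mul] at hM
  obtain ⟨h₁, h₂, h₃, h₄⟩ := hM
  refine ⟨?_, ?_, ?_, ?_⟩ <;> grind

/-- The image of a symplectic matrix under a ring homomorphism is symplectic. -/
theorem IsSymplectic.map {g : ℕ} {R S : Type*} [CommRing R] [CommRing S]
    {M : Matrix (Fin g ⊕ Fin g) (Fin g ⊕ Fin g) R} (hM : IsSymplectic M) (f : R →+* S) :
    IsSymplectic (M.map f) := by
  have hJ : (symJ g R).map f = symJ g S := by
    simp [symJ, fromBlocks_map, Matrix.map_neg]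
  rw [IsSymplectic, ← hJ, ← transpose_map, ← Matrix.map_mul, ← Matrix.map_mul, hM]

/-- For a real symplectic matrix `M = [[A,B],[C,D]]` and `τ` in the Siegel upper half
space, `Cτ + D` is invertible and `(Aτ + B)(Cτ + D)⁻¹` again lies in the Siegel upper
half space. -/
theorem symplectic_action_wellDefined (g : ℕ) (A B C D : Matrix (Fin g) (Fin g) ℝ)
    (hM : IsSymplectic (Matrix.fromBlocks A B C D))
    (τ : Matrix (Fin g) (Fin g) ℂ) (hτ : τ ∈ SiegelUpperHalfSpace g) :
    IsUnit (C.map (fun x : ℝ => (x : ℂ)) * τ + D.map (fun x : ℝ => (x : ℂ))) ∧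
      (A.map (fun x : ℝ => (x : ℂ)) * τ + B.map (fun x : ℝ => (x : ℂ))) *
        (C.map (fun x : ℝ => (x : ℂ)) * τ + D.map (fun x : ℝ => (x : ℂ)))⁻¹ ∈
          SiegelUpperHalfSpace g := by
  obtain ⟨hsymm, hY⟩ := hτ
  have hMc := hM.map Complex.ofRealHom
  rw [fromBlocks_map] at hMc
  obtain ⟨h₁, h₂, h₃, h₄⟩ := hMc.fromBlocks_relations
  have hH (X : Matrix (Fin g) (Fin g) ℝ) :
      (X.map Complex.ofRealHom)ᴴ = (X.map Complex.ofRealHom)ᵀ := by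
    ext i j
    simp
  have hHA := hH A
  have hHB := hH B
  have hHC := hH C
  have hHD := hH D
  change IsUnit (C.map Complex.ofRealHom * τ + D.map Complex.ofRealHom) ∧
    (A.map Complex.ofRealHom * τ + B.map Complex.ofRealHom) *
      (C.map Complex.ofRealHom * τ + D.map Complex.ofRealHom)⁻¹ ∈ SiegelUpperHalfSpace g
  generalize A.map Complex.ofRealHom = A, B.map Complex.ofRealHom = B,
    C.map Complex.ofRealHom = C, D.map Complex.ofRealHom = D at *
  have key (σ : Matrix (Fin g) (Fin g) ℂ) :
      (σ * Cᵀ + Dᵀ) * (A * τ + B) - (σ * Aᵀ + Bᵀ) * (C * τ + D) = τ - σ :=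
    calc
      _ = σ * (Cᵀ * A - Aᵀ * C) * τ + (Dᵀ * B - Bᵀ * D) - σ * (Aᵀ * D - Cᵀ * B) +
          (Dᵀ * A - Bᵀ * C) * τ := by noncomm_ring
      _ = τ - σ := by
        rw [h₁, h₂, h₃, h₄]
        noncomm_ring
  refine ⟨isUnit_of_conjTranspose_mul_sub_eq_smul_posDef (P := A * τ + B) hY.map_ofReal ?_,
    mul_inv_isSymm_and_im_posDef hY.map_ofReal ?_ ?_⟩
  · rw [← hsymm.sub_conjTranspose, ← key]
    simp only [conjTranspose_add, conjTranspose_mul, hHA, hHB, hHC, hHD]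
  · have hT := key τ
    rw [sub_self, sub_eq_zero] at hT
    simpa only [transpose_add, transpose_mul, hsymm.eq] using hT.symm
  · rw [← hsymm.sub_conjTranspose, ← key]
    simp only [conjTranspose_add, conjTranspose_mul, hHA, hHB, hHC, hHD]
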